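/- Every Borel E₀-large set X ⊆ 2^ω contains a canonical E₀-large subset, i.e., there is an E₀-array u such that D_u ⊆ X. -/

import Mathlib

open MeasureTheory

abbrev Cantor : Type := ℕ → Bool

/-- The equivalence relation `E₀`: eventual agreement. -/
def eZero (x y : Cantor) : Prop := {k | x k ≠ y k}.Finite

/-- The equivalence relation `Eₑ`: the set of disagreements is finite with even cardinality. -/
def eEven (x y : Cantor) : Prop := {k | x k ≠ y k}.Finite ∧ Even ({k | x k ≠ y k}.ncard)

/-- A set is coanalytic (`Π¹₁`) iff its complement is analytic. -/
def IsCoanalytic {α : Type*} [TopologicalSpace α] (S : Set α) : Prop := AnalyticSet Sᶜ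

/-- A perfect set: nonempty, closed, no isolated points. -/
def PerfectSet (X : Set Cantor) : Prop := Perfect X ∧ X.Nonempty

/-- `E` restricted to the Borel set `X` is smooth. -/
def RelSmoothOn (E : Cantor → Cantor → Prop) (X : Set Cantor) : Prop :=
  ∃ f : X → Cantor, Measurable f ∧ ∀ x y : X, (E x y ↔ f x = f y)

/-- A Borel set is `E₀`-large iff `E₀` restricted to it is not smooth. -/
def E0Large (X : Set Cantor) : Prop := ¬ RelSmoothOn eZero X

/-- An `E₀`-array: strings `u n i` with equal positive lengths and `u n 0 ≠ u n 1`. -/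
structure E0Array where
  u : ℕ → Bool → List Bool
  len_eq : ∀ n, (u n false).length = (u n true).length
  len_pos : ∀ n, 1 ≤ (u n false).length
  ne : ∀ n, u n false ≠ u n true

/-- The point `x_u^a = u 0 (a 0) ⌢ u 1 (a 1) ⌢ ⋯`. (Since every block has length
at least one, the join of the first `m+1` blocks has length `> m`.) -/
def xua (U : E0Array) (a : Cantor) : Cantor := fun m =>
  (((List.range (m + 1)).map (fun n => U.u n (a n))).flatten).getD m false

/-- The canonical `E₀`-large set `D_u` determined by the array `u`. -/
def Du (U : E0Array) : Set Cantor := Set.range (xua U)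

/-- A double-bubble system. -/
structure DBS (D E : Cantor → Cantor → Prop) : Prop where
  equivD : Equivalence D
  equivE : Equivalence E
  borelD : MeasurableSet {p : Cantor × Cantor | D p.1 p.2}
  borelE : MeasurableSet {p : Cantor × Cantor | E p.1 p.2}
  countableD : ∀ x, {y | D x y}.Countable
  countableE : ∀ x, {y | E x y}.Countable
  sub : ∀ x y, D x y → E x y
  double : ∀ x, ∃ y, E x y ∧ ¬ D x y ∧ ∀ z, E x z → (D x z ∨ D y z)

/-- `⟨D,E⟩ ⊑ ⟨D',E'⟩`: extension of double-bubble systems. -/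
def DBSle (D E D' E' : Cantor → Cantor → Prop) : Prop :=
  (∀ x y, D x y → D' x y) ∧ (∀ x y, E x y → E' x y) ∧
    (∀ x y, E x y → ¬ D x y → ¬ D' x y)


/-- Concatenation of a finite binary string with an infinite one. -/
def prependWord (w : List Bool) (z : Cantor) : Cantor := fun m => w.getD m (z (m - w.length))

/-- The infinite string `x` with its first `n` entries removed. -/
def dropPrefix (n : ℕ) (x : Cantor) : Cantor := fun m => x (n + m)

/-- Any two `E₀`-equivalent points of `B` are equal. -/
def IsPartialTransversal (B : Set Cantor) : Prop := ∀ x ∈ B, ∀ y ∈ B, eZero x y → x = y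

/-- `A` is covered by countably many Borel partial transversals of `E₀`. -/
def IsSmall (A : Set Cantor) : Prop :=
  ∃ S : Set (Set Cantor), S.Countable ∧ (∀ B ∈ S, MeasurableSet B ∧ IsPartialTransversal B) ∧
    A ⊆ ⋃₀ S

theorem prependWord_of_lt {w : List Bool} {z : Cantor} {m : ℕ} (h : m < w.length) (d : Bool) :
    prependWord w z m = w.getD m d := by
  simp [prependWord, h]

theorem prependWord_length_add (w : List Bool) (z : Cantor) (m : ℕ) :
    prependWord w z (w.length + m) = z m := by
  simp [prependWord]

theorem prependWord_nil (z : Cantor) : prependWord [] z = z := by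
  funext m
  simp [prependWord]

theorem prependWord_append (v w : List Bool) (z : Cantor) :
    prependWord (v ++ w) z = prependWord v (prependWord w z) := by
  funext m
  by_cases h : m < v.length
  · rw [prependWord_of_lt h false, prependWord_of_lt (by simp; omega) false,
      List.getD_append _ _ _ _ h]
  · obtain ⟨k, rfl⟩ := Nat.exists_eq_add_of_le (not_lt.1 h)
    rw [prependWord_length_add]
    simp [prependWord, List.getElem?_append_right, Nat.sub_add_eq]

theorem prependWord_injective (w : List Bool) : Function.Injective (prependWord w) := by
  intro x y h
  funext m
  rw [← prependWord_length_add w x, h, prependWord_length_add]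

theorem measurable_prependWord (w : List Bool) : Measurable (prependWord w) := by
  refine measurable_pi_lambda _ fun m => ?_
  by_cases h : m < w.length
  · simp only [prependWord_of_lt h false]
    exact measurable_const
  · obtain ⟨k, rfl⟩ := Nat.exists_eq_add_of_le (not_lt.1 h)
    simp only [prependWord_length_add]
    exact measurable_pi_apply k

theorem measurable_dropPrefix (n : ℕ) : Measurable (dropPrefix n) :=
  measurable_pi_lambda _ fun _ => measurable_pi_apply _

theorem prependWord_ofFn_dropPrefix (x : Cantor) (n : ℕ) :
    prependWord (List.ofFn fun i : Fin n => x i) (dropPrefix n x) = x := by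
  funext m
  by_cases h : m < n
  · rw [prependWord_of_lt (by simpa) false]
    simp [h]
  · obtain ⟨k, rfl⟩ := Nat.exists_eq_add_of_le (not_lt.1 h)
    simp [prependWord, dropPrefix]

theorem eZero_symm {x y : Cantor} (h : eZero x y) : eZero y x := by
  simpa only [eZero, ne_comm] using h

theorem eZero_trans {x y z : Cantor} (h : eZero x y) (h' : eZero y z) : eZero x z := by
  refine (h.union h').subset fun k hk => ?_
  by_contra hc
  simp only [Set.mem_union, Set.mem_ofPred_eq, not_or, not_not] at hc
  exact hk (hc.1.trans hc.2)

theorem eZero_of_prependWord {w : List Bool} {x y : Cantor}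
    (h : eZero (prependWord w x) (prependWord w y)) : eZero x y := by
  refine (h.preimage (f := fun m => w.length + m)
    ((add_right_injective w.length).injOn)).subset fun k hk => ?_
  simpa [prependWord_length_add] using hk

theorem exists_dropPrefix_eq {x y : Cantor} (h : eZero x y) (k : ℕ) :
    ∃ n, k < n ∧ dropPrefix n x = dropPrefix n y := by
  obtain ⟨N, hN⟩ := h.bddAbove
  refine ⟨max N k + 1, by omega, ?_⟩
  funext m
  by_contra hc
  have := hN hc
  omega

theorem eZero_prependWord_dropPrefix (w : List Bool) (x : Cantor) :
    eZero (prependWord w (dropPrefix w.length x)) x := by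
  refine (Set.finite_lt_nat w.length).subset fun k hk => ?_
  by_contra hc
  obtain ⟨j, rfl⟩ := Nat.exists_eq_add_of_le (not_lt.1 hc)
  exact hk (prependWord_length_add _ _ _)

theorem eZero_iff_exists_word {x y : Cantor} :
    eZero x y ↔ ∃ w : List Bool, prependWord w (dropPrefix w.length x) = y := by
  constructor
  · intro h
    obtain ⟨n, -, hn⟩ := exists_dropPrefix_eq h 0
    refine ⟨List.ofFn fun i : Fin n => y i, ?_⟩
    rw [List.length_ofFn, hn, prependWord_ofFn_dropPrefix]
  · rintro ⟨w, rfl⟩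
    exact eZero_symm (eZero_prependWord_dropPrefix w x)

theorem IsSmall.mono {A B : Set Cantor} (hB : IsSmall B) (h : A ⊆ B) : IsSmall A := by
  obtain ⟨S, hc, hS, hBS⟩ := hB
  exact ⟨S, hc, hS, h.trans hBS⟩

theorem isSmall_empty : IsSmall ∅ :=
  ⟨∅, Set.countable_empty, by simp, Set.empty_subset _⟩

theorem isSmall_iUnion {ι : Type*} [Countable ι] {A : ι → Set Cantor} (h : ∀ i, IsSmall (A i)) :
    IsSmall (⋃ i, A i) := by
  choose S hc hS hA using h
  refine ⟨⋃ i, S i, Set.countable_iUnion hc, ?_, ?_⟩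
  · intro B hB
    obtain ⟨i, hi⟩ := Set.mem_iUnion.1 hB
    exact hS i B hi
  · exact Set.iUnion_subset fun i => (hA i).trans (Set.sUnion_subset_sUnion
      (Set.subset_iUnion S i))

theorem IsPartialTransversal.isSmall {B : Set Cantor} (h : IsPartialTransversal B)
    (hB : MeasurableSet B) : IsSmall B :=
  ⟨{B}, Set.countable_singleton B, by simp [h, hB], by simp⟩

theorem IsSmall.union {A B : Set Cantor} (hA : IsSmall A) (hB : IsSmall B) :
    IsSmall (A ∪ B) := by
  rw [Set.union_eq_iUnion]
  exact isSmall_iUnion fun b => by cases b <;> assumption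

theorem IsSmall.image_prependWord {A : Set Cantor} (hA : IsSmall A) (w : List Bool) :
    IsSmall (prependWord w '' A) := by
  obtain ⟨S, hc, hS, hAS⟩ := hA
  refine ⟨(fun B => prependWord w '' B) '' S, hc.image _, ?_, ?_⟩
  · rintro _ ⟨B, hB, rfl⟩
    refine ⟨(hS B hB).1.image_of_measurable_injOn (measurable_prependWord w)
      (prependWord_injective w).injOn, ?_⟩
    rintro _ ⟨x, hx, rfl⟩ _ ⟨y, hy, rfl⟩ h
    rw [(hS B hB).2 x hx y hy (eZero_of_prependWord h)]
  · rintro _ ⟨x, hx, rfl⟩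
    obtain ⟨B, hB, hxB⟩ := hAS hx
    exact ⟨_, ⟨B, hB, rfl⟩, x, hxB, rfl⟩

theorem IsSmall.relSmoothOn {X : Set Cantor} (hX : IsSmall X) : RelSmoothOn eZero X := by
  classical
  obtain ⟨S, hc, hS, hXS⟩ := hX
  have hcS : Countable S := hc
  rcases isEmpty_or_nonempty S with hemp | hne
  · have hX0 : ∀ x : X, False := fun x => by
      obtain ⟨B, hB, -⟩ := hXS x.2
      exact hemp.false ⟨B, hB⟩
    exact ⟨fun x => (hX0 x).elim, @measurable_of_empty _ _ _ _ ⟨hX0⟩ _, fun x => (hX0 x).elim⟩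
  obtain ⟨e, he⟩ := exists_surjective_nat (S × ℕ × Bool)
  let P : S × ℕ × Bool → Set Cantor := fun p =>
    {x | ∃ w : List Bool, prependWord w (dropPrefix w.length x) ∈ p.1.1 ∧
      prependWord w (dropPrefix w.length x) p.2.1 = p.2.2}
  have hP : ∀ p x, x ∈ P p ↔ ∃ y, eZero x y ∧ y ∈ p.1.1 ∧ y p.2.1 = p.2.2 := by
    intro p x
    simp only [P, Set.mem_ofPred_eq, eZero_iff_exists_word]
    constructor
    · rintro ⟨w, h⟩
      exact ⟨_, ⟨w, rfl⟩, h⟩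
    · rintro ⟨_, ⟨w, rfl⟩, h⟩
      exact ⟨w, h⟩
  have hPm : ∀ p, MeasurableSet (P p) := by
    intro p
    have : P p = ⋃ w : List Bool, (fun x => prependWord w (dropPrefix w.length x)) ⁻¹'
        (p.1.1 ∩ (fun y : Cantor => y p.2.1) ⁻¹' {p.2.2}) := by
      ext x
      simp [P]
    rw [this]
    exact MeasurableSet.iUnion fun w =>
      ((measurable_prependWord w).comp (measurable_dropPrefix _))
        ((hS _ p.1.2).1.inter (measurable_pi_apply _ (measurableSet_singleton _)))
  refine ⟨fun x m => decide (x.1 ∈ P (e m)), ?_, ?_⟩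
  · refine measurable_pi_lambda _ fun m => measurable_to_bool ?_
    have : (fun x : X => decide (x.1 ∈ P (e m))) ⁻¹' {true} = Subtype.val ⁻¹' P (e m) := by
      ext x
      simp
    rw [this]
    exact measurable_subtype_coe (hPm _)
  · intro x y
    constructor
    · intro h
      funext m
      rw [decide_eq_decide, hP, hP]
      exact ⟨fun ⟨z, hz, h'⟩ => ⟨z, eZero_trans (eZero_symm h) hz, h'⟩,
        fun ⟨z, hz, h'⟩ => ⟨z, eZero_trans h hz, h'⟩⟩
    · intro h
      obtain ⟨B, hB, hxB⟩ := hXS x.2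
      have key : ∀ k, ∃ z, eZero y z ∧ z ∈ B ∧ z k = x.1 k := by
        intro k
        obtain ⟨m, hm⟩ := he (⟨B, hB⟩, k, x.1 k)
        have h1 := congrFun h m
        rw [decide_eq_decide, hm, hP, hP] at h1
        exact h1.1 ⟨x, by simp [eZero], hxB, rfl⟩
      obtain ⟨z, hz, hzB, -⟩ := key 0
      have hzx : z = x := by
        funext k
        obtain ⟨z', hz', hzB', hk⟩ := key k
        rw [(hS B hB).2 z hzB z' hzB' (eZero_trans (eZero_symm hz) hz'), hk]
      exact eZero_symm (hzx ▸ hz)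

/-- A Borel set that is not small has non-small common sections along two distinct strings of
the same length. -/
theorem exists_words_not_isSmall {A : Set Cantor} (hA : MeasurableSet A) (hs : ¬ IsSmall A) :
    ∃ v w : List Bool, v.length = w.length ∧ 1 ≤ v.length ∧ v ≠ w ∧
      ¬ IsSmall (prependWord v ⁻¹' A ∩ prependWord w ⁻¹' A) := by
  by_contra! hcon
  let ι := {p : List Bool × List Bool // p.1.length = p.2.length ∧ 1 ≤ p.1.length ∧ p.1 ≠ p.2}
  let D : ι → Set Cantor := fun p =>
    prependWord p.1.1 '' (prependWord p.1.1 ⁻¹' A ∩ prependWord p.1.2 ⁻¹' A)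
  have hDm : ∀ p, MeasurableSet (D p) := fun p =>
    ((measurable_prependWord _ hA).inter (measurable_prependWord _ hA)).image_of_measurable_injOn
      (measurable_prependWord _) (prependWord_injective _).injOn
  have hD : IsSmall (⋃ p, D p) := isSmall_iUnion fun p =>
    (hcon _ _ p.2.1 p.2.2.1 p.2.2.2).image_prependWord _
  have htr : IsPartialTransversal (A \ ⋃ p, D p) := by
    rintro x ⟨hxA, hxD⟩ y ⟨hyA, -⟩ hxy
    by_contra hne
    obtain ⟨k, hk⟩ := Function.ne_iff.1 hne
    obtain ⟨n, hkn, hn⟩ := exists_dropPrefix_eq hxy k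
    refine hxD (Set.mem_iUnion.2 ⟨⟨(List.ofFn fun i : Fin n => x i, List.ofFn fun i : Fin n => y i),
      by simp, by simp; omega, ?_⟩, dropPrefix n x, ⟨?_, ?_⟩, ?_⟩)
    · intro h
      exact hk (congrFun (List.ofFn_injective h) ⟨k, hkn⟩)
    · simpa [prependWord_ofFn_dropPrefix] using hxA
    · simpa [hn, prependWord_ofFn_dropPrefix] using hyA
    · simp [prependWord_ofFn_dropPrefix]
  refine hs (((htr.isSmall (hA.diff (MeasurableSet.iUnion hDm))).union hD).mono fun x hx => ?_)
  by_cases h : x ∈ ⋃ p, D p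
  · exact Or.inr h
  · exact Or.inl ⟨hx, h⟩

/-- An injective continuous image of a Polish space admits countable Borel covers witnessing
a form of completeness. -/
theorem exists_complete_covers_range {Y : Type*} [TopologicalSpace Y] [PolishSpace Y]
    {f : Y → Cantor} (hf : Continuous f) (hinj : Function.Injective f) :
    ∃ C : ℕ → ℕ → Set Cantor, (∀ n k, MeasurableSet (C n k)) ∧
      (∀ n, Set.range f ⊆ ⋃ k, C n k) ∧
      ∀ (b : ℕ → ℕ) (s : ℕ → Cantor) (x : Cantor),
        (∀ n, ∀ m ≤ n, s n ∈ C m (b m)) → Filter.Tendsto s Filter.atTop (nhds x) →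
          x ∈ Set.range f := by
  rcases isEmpty_or_nonempty Y with hY | hY
  · refine ⟨fun _ _ => ∅, by simp, by simp [Set.range_eq_empty f], fun b s x h => ?_⟩
    exact (h 0 0 le_rfl).elim
  let := TopologicalSpace.upgradeIsCompletelyMetrizable Y
  let r : ℕ → ℝ := fun n => (1 / 2) ^ n
  have hr : ∀ n, 0 < r n := fun n => by positivity
  refine ⟨fun n k => f '' Metric.closedBall (TopologicalSpace.denseSeq Y k) (r n), ?_, ?_, ?_⟩
  · let : MeasurableSpace Y := borel Y
    have : BorelSpace Y := ⟨rfl⟩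
    intro n k
    exact Metric.isClosed_closedBall.measurableSet.image_of_continuousOn_injOn
      hf.continuousOn hinj.injOn
  · rintro n _ ⟨y, rfl⟩
    obtain ⟨k, hk⟩ := (TopologicalSpace.denseRange_denseSeq Y).exists_dist_lt y (hr n)
    refine Set.mem_iUnion.2 ⟨k, y, ?_, rfl⟩
    exact Metric.mem_closedBall.2 hk.le
  · intro b s x h hx
    have h0 : ∀ n, ∃ y, f y = s n := fun n => by
      obtain ⟨y, -, hy⟩ := h n 0 (Nat.zero_le n)
      exact ⟨y, hy⟩
    choose y hy using h0
    have hball : ∀ n, ∀ m ≤ n,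
        dist (y n) (TopologicalSpace.denseSeq Y (b m)) ≤ r m := by
      intro n m hm
      obtain ⟨y', hy', he⟩ := h n m hm
      rw [← hy n] at he
      exact hinj he ▸ hy'
    have hcau : CauchySeq y := by
      refine cauchySeq_of_le_tendsto_0 (fun n => 2 * r n) (fun n m N hn hm => ?_) ?_
      · have h1 := hball n N hn
        have h2 := hball m N hm
        have h3 := dist_triangle_right (y n) (y m) (TopologicalSpace.denseSeq Y (b N))
        linarith
      · simpa only [mul_zero] using (tendsto_pow_atTop_nhds_zero_of_lt_one (r := (1 / 2 : ℝ))
          (by norm_num) (by norm_num)).const_mul 2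
    obtain ⟨l, hl⟩ := cauchySeq_tendsto_of_complete hcau
    have h1 : Filter.Tendsto s Filter.atTop (nhds (f l)) := by
      have := (hf.tendsto l).comp hl
      rwa [show f ∘ y = s from funext hy] at this
    exact ⟨l, tendsto_nhds_unique h1 hx⟩

theorem exists_complete_covers {X : Set Cantor} (hX : MeasurableSet X) :
    ∃ C : ℕ → ℕ → Set Cantor, (∀ n k, MeasurableSet (C n k)) ∧ (∀ n, X ⊆ ⋃ k, C n k) ∧
      ∀ (b : ℕ → ℕ) (s : ℕ → Cantor) (x : Cantor),
        (∀ n, ∀ m ≤ n, s n ∈ C m (b m)) → Filter.Tendsto s Filter.atTop (nhds x) → x ∈ X := by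
  have : PolishSpace Cantor := { }
  obtain ⟨t, hle, hpol, hcl, -⟩ := hX.isClopenable
  let : TopologicalSpace X := @instTopologicalSpaceSubtype Cantor (· ∈ X) t
  have : PolishSpace X := @IsClosed.polishSpace Cantor t hpol X hcl
  have hf : @Continuous X Cantor _ Pi.topologicalSpace Subtype.val :=
    continuous_le_rng hle (@continuous_subtype_val Cantor t X)
  simpa only [Subtype.range_coe] using exists_complete_covers_range hf Subtype.val_injective

/-- One step of the fusion: split along two strings so that every concatenation with a string
from `W` lands in a single piece of the cover `C`. -/
theorem exists_fusion_step {X A : Set Cantor} (hA : MeasurableSet A) (hs : ¬ IsSmall A)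
    {C : ℕ → Set Cantor} (hC : ∀ k, MeasurableSet (C k)) (hXC : X ⊆ ⋃ k, C k)
    (W : Finset (List Bool)) (hW : ∀ w ∈ W, ∀ z ∈ A, prependWord w z ∈ X) :
    ∃ (u : Bool → List Bool) (A' : Set Cantor),
      (u false).length = (u true).length ∧ 1 ≤ (u false).length ∧ u false ≠ u true ∧
      MeasurableSet A' ∧ ¬ IsSmall A' ∧ (∀ i, ∀ z ∈ A', prependWord (u i) z ∈ A) ∧
      ∀ w ∈ W, ∀ i, ∃ k, ∀ z ∈ A', prependWord (w ++ u i) z ∈ C k := by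
  obtain ⟨v, w, hlen, hpos, hne, hsm⟩ := exists_words_not_isSmall hA hs
  set u : Bool → List Bool := fun i => cond i w v
  set A₀ := prependWord v ⁻¹' A ∩ prependWord w ⁻¹' A
  have hA₀m : MeasurableSet A₀ :=
    (measurable_prependWord v hA).inter (measurable_prependWord w hA)
  have hA₀u : ∀ i, ∀ z ∈ A₀, prependWord (u i) z ∈ A := by
    rintro (_ | _) z hz
    exacts [hz.1, hz.2]
  let E : (W × Bool → ℕ) → Set Cantor := fun g =>
    A₀ ∩ ⋂ p : W × Bool, prependWord (p.1.1 ++ u p.2) ⁻¹' C (g p)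
  have hE : ∃ g, ¬ IsSmall (E g) := by
    by_contra! hcon
    refine hsm ((isSmall_iUnion hcon).mono fun z hz => ?_)
    have : ∀ p : W × Bool, ∃ k, prependWord (p.1.1 ++ u p.2) z ∈ C k := by
      intro p
      rw [prependWord_append]
      exact Set.mem_iUnion.1 (hXC (hW _ p.1.2 _ (hA₀u p.2 z hz)))
    choose g hg using this
    exact Set.mem_iUnion.2 ⟨g, hz, Set.mem_iInter.2 hg⟩
  obtain ⟨g, hg⟩ := hE
  refine ⟨u, E g, hlen, hpos, hne, ?_, hg, fun i z hz => hA₀u i z hz.1, ?_⟩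
  · exact hA₀m.inter (MeasurableSet.iInter fun p => measurable_prependWord _ (hC _))
  · intro x hx i
    exact ⟨g (⟨x, hx⟩, i), fun z hz => Set.mem_iInter.1 hz.2 (⟨x, hx⟩, i)⟩

/-- The concatenation of the first `n` blocks of `x_u^a`. -/
def initialBlocks (u : ℕ → Bool → List Bool) (a : Cantor) (n : ℕ) : List Bool :=
  ((List.range n).map fun i => u i (a i)).flatten

theorem initialBlocks_succ (u : ℕ → Bool → List Bool) (a : Cantor) (n : ℕ) :
    initialBlocks u a (n + 1) = initialBlocks u a n ++ u n (a n) := by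
  simp [initialBlocks, List.range_succ]

theorem initialBlocks_mono (u : ℕ → Bool → List Bool) (a : Cantor) {m n : ℕ} (h : m ≤ n) :
    initialBlocks u a m <+: initialBlocks u a n := by
  induction n, h using Nat.le_induction with
  | base => exact List.prefix_rfl
  | succ n _ ih =>
    rw [initialBlocks_succ]
    exact ih.trans (List.prefix_append _ _)

theorem le_length_initialBlocks (U : E0Array) (a : Cantor) (n : ℕ) :
    n ≤ (initialBlocks U.u a n).length := by
  induction n with
  | zero => simp
  | succ n ih =>
    have : 1 ≤ (U.u n (a n)).length := by
      cases a n
      · exact U.len_pos n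
      · exact U.len_eq n ▸ U.len_pos n
    rw [initialBlocks_succ, List.length_append]
    omega

theorem tendsto_prependWord_initialBlocks (U : E0Array) (a : Cantor) (z : ℕ → Cantor) :
    Filter.Tendsto (fun n => prependWord (initialBlocks U.u a (n + 1)) (z n)) Filter.atTop
      (nhds (xua U a)) := by
  rw [tendsto_pi_nhds]
  intro m
  refine tendsto_const_nhds.congr' ?_
  filter_upwards [Filter.eventually_ge_atTop m] with n hn
  have hm : m < (initialBlocks U.u a (m + 1)).length := le_length_initialBlocks U a (m + 1)
  obtain ⟨t, ht⟩ := initialBlocks_mono U.u a (Nat.succ_le_succ hn)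
  rw [← ht, prependWord_append, prependWord_of_lt hm false]
  rfl

/-- Every Borel `E₀`-large set contains a canonical `E₀`-large subset. -/
theorem e0large_contains_canonical (X : Set Cantor) (hX : MeasurableSet X)
    (hXl : E0Large X) :
    ∃ U : E0Array, Du U ⊆ X := by
  classical
  have hXs : ¬ IsSmall X := fun h => hXl h.relSmoothOn
  obtain ⟨C, hCm, hXC, hC⟩ := exists_complete_covers hX
  let Good : Set Cantor × Finset (List Bool) → Prop := fun p =>
    MeasurableSet p.1 ∧ ¬ IsSmall p.1 ∧ ∀ w ∈ p.2, ∀ z ∈ p.1, prependWord w z ∈ X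
  have step : ∀ (n : ℕ) (p : {p // Good p}), ∃ (u : Bool → List Bool) (q : {p // Good p}),
      ((u false).length = (u true).length ∧ 1 ≤ (u false).length ∧ u false ≠ u true) ∧
      (∀ i, ∀ z ∈ q.1.1, prependWord (u i) z ∈ p.1.1) ∧
      ∀ w ∈ p.1.2, ∀ i, w ++ u i ∈ q.1.2 ∧
        ∃ k, ∀ z ∈ q.1.1, prependWord (w ++ u i) z ∈ C n k := by
    rintro n ⟨⟨A, W⟩, hA, hs, hW⟩
    obtain ⟨u, A', h1, h2, h3, h4, h5, h6, h7⟩ :=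
      exists_fusion_step hA hs (hCm n) (hXC n) W hW
    refine ⟨u, ⟨(A', (W ×ˢ Finset.univ).image fun p => p.1 ++ u p.2), h4, h5, ?_⟩,
      ⟨h1, h2, h3⟩, h6, fun w hw i => ⟨?_, h7 w hw i⟩⟩
    · intro w' hw' z hz
      obtain ⟨⟨w, i⟩, hp, rfl⟩ := Finset.mem_image.1 hw'
      rw [prependWord_append]
      exact hW w (Finset.mem_product.1 hp).1 _ (h6 i z hz)
    · exact Finset.mem_image.2 ⟨(w, i), by simpa using hw, rfl⟩
  choose u next hu hnext hcov using step
  let p : ℕ → {p // Good p} := fun n =>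
    Nat.rec ⟨(X, {[]}), hX, hXs, by simp [prependWord_nil]⟩ (fun n q => next n q) n
  let U : E0Array := ⟨fun n => u n (p n), fun n => (hu n (p n)).1, fun n => (hu n (p n)).2.1,
    fun n => (hu n (p n)).2.2⟩
  refine ⟨U, ?_⟩
  rintro _ ⟨a, rfl⟩
  have hmem : ∀ n, initialBlocks U.u a n ∈ (p n).1.2 := by
    intro n
    induction n with
    | zero => simp [initialBlocks, p]
    | succ n ih =>
      rw [initialBlocks_succ]
      exact (hcov n (p n) _ ih (a n)).1
  have hne : ∀ n, ∃ z, z ∈ (p n).1.1 := by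
    intro n
    by_contra! h
    exact (p n).2.2.1 (Set.eq_empty_of_forall_notMem h ▸ isSmall_empty)
  choose z hz using hne
  choose b hb using fun n => (hcov n (p n) _ (hmem n) (a n)).2
  have hdesc : ∀ m n, m ≤ n → ∀ z ∈ (p n).1.1, ∃ z' ∈ (p m).1.1,
      prependWord (initialBlocks U.u a n) z = prependWord (initialBlocks U.u a m) z' := by
    intro m n hmn
    induction n, hmn using Nat.le_induction with
    | base => exact fun z hz => ⟨z, hz, rfl⟩
    | succ n _ ih =>
      intro z hz
      rw [initialBlocks_succ, prependWord_append]
      exact ih _ (hnext n (p n) (a n) z hz)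
  refine hC b _ _ (fun n m hmn => ?_)
    (tendsto_prependWord_initialBlocks U a fun n => z (n + 1))
  obtain ⟨z', hz', he⟩ := hdesc (m + 1) (n + 1) (by omega) _ (hz (n + 1))
  rw [he, initialBlocks_succ]
  exact hb m z' hz'
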